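/- For integers n and i with n/2 < i < n, the sets A(n,i) \ B(n,i) and B(i, n−i) are in bijection; in particular a(n,i) − b(n,i) = b(i, n−i). -/

import Mathlib

/-- `listPow Y k` is the sequence `Y` repeated `k` times (i.e. `Y^k`). -/
def listPow {α : Type*} (Y : List α) : ℕ → List α
  | 0 => []
  | k + 1 => Y ++ listPow Y k

/-- The curling number of a finite sequence `S`: the largest `k` such that
`S = X ++ Y^k` for some (possibly empty) `X` and nonempty `Y`. -/
noncomputable def CN {α : Type*} (S : List α) : ℕ :=
  sSup {k | ∃ X Y : List α, Y ≠ [] ∧ S = X ++ listPow Y k}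

/-- A nonempty sequence is primitive if it is not a power `T^i` with `i ≥ 2`. -/
def Primitive {α : Type*} (S : List α) : Prop :=
  S ≠ [] ∧ ∀ (T : List α) (i : ℕ), 2 ≤ i → S ≠ listPow T i

/-- `T` is a proper suffix of `S`: a suffix which is strictly shorter than `S`. -/
def ProperSuffix {α : Type*} (T S : List α) : Prop := T <:+ S ∧ T.length < S.length

/-- A sequence `S` with curling number `k` is robust if no proper suffix of
`S^(k+1)` has curling number `≥ k + 1`. -/
def Robust {α : Type*} (S : List α) : Prop :=
  ∀ T : List α, ProperSuffix T (listPow S (CN S + 1)) → CN T ≤ CN S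

/-- `c(n,k)`: the number of binary sequences of length `n` with curling number `k`. -/
noncomputable def cCount (n k : ℕ) : ℕ :=
  {S : List Bool | S.length = n ∧ CN S = k}.ncard

/-- `p(n,k)`: the number of primitive binary sequences of length `n` with curling number `k`. -/
noncomputable def pCount (n k : ℕ) : ℕ :=
  {S : List Bool | S.length = n ∧ CN S = k ∧ Primitive S}.ncard

/-- `p'(n,k)`: the number of primitive robust binary sequences of length `n`
with curling number `k`. -/
noncomputable def pCount' (n k : ℕ) : ℕ :=
  {S : List Bool | S.length = n ∧ CN S = k ∧ Primitive S ∧ Robust S}.ncard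

/-- `q(n,k) = Σ_{i=1}^{k} p(n,i)`. -/
noncomputable def qCount (n k : ℕ) : ℕ := ∑ i ∈ Finset.Icc 1 k, pCount n i

/-- `S^{[i]}`: the suffix of `S` of length `i`. -/
def suffLen {α : Type*} (S : List α) (i : ℕ) : List α := S.drop (S.length - i)

/-- `A(n,i)`: binary sequences `S` of length `n` with `CN S = 1` and `CN (S^{[i]} S) = 1`. -/
def setA (n i : ℕ) : Set (List Bool) :=
  {S | S.length = n ∧ CN S = 1 ∧ CN (suffLen S i ++ S) = 1}

/-- `B(n,i)`: binary sequences `S` of length `n` with `CN S = 1` and `CN (S S^{[i]} S) = 1`. -/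
def setB (n i : ℕ) : Set (List Bool) :=
  {S | S.length = n ∧ CN S = 1 ∧ CN (S ++ suffLen S i ++ S) = 1}

/-- `E(n,i,j)`: binary sequences `S` of length `n` with `CN S = 1`
and `S^{[i]} S ∈ B(n+i, j)`. -/
def setE (n i j : ℕ) : Set (List Bool) :=
  {S | S.length = n ∧ CN S = 1 ∧ (suffLen S i ++ S) ∈ setB (n + i) j}

noncomputable def aCount (n i : ℕ) : ℕ := (setA n i).ncard
noncomputable def bCount (n i : ℕ) : ℕ := (setB n i).ncard
noncomputable def eCount (n i j : ℕ) : ℕ := (setE n i j).ncard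

theorem length_listPow {α : Type*} (Y : List α) (k : ℕ) :
    (listPow Y k).length = k * Y.length := by
  induction k with
  | zero => simp [listPow]
  | succ k ih => simp [listPow, ih]; ring

theorem listPow_add {α : Type*} (Y : List α) (a b : ℕ) :
    listPow Y (a + b) = listPow Y a ++ listPow Y b := by
  induction a with
  | zero => simp [listPow]
  | succ a ih => rw [Nat.add_right_comm]; simp [listPow, ih]

/-- `R` begins with a nonempty square. -/
def HasSquarePrefix {α : Type*} (R : List α) : Prop :=
  ∃ p, 0 < p ∧ 2 * p ≤ R.length ∧ ∀ j < p, R[j]? = R[j + p]?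

theorem HasSquarePrefix.append {α : Type*} {R : List α} (h : HasSquarePrefix R) (X : List α) :
    HasSquarePrefix (R ++ X) := by
  obtain ⟨p, hp, hl, h⟩ := h
  refine ⟨p, hp, by simp; omega, fun j hj => ?_⟩
  rw [List.getElem?_append_left (by omega), List.getElem?_append_left (by omega), h j hj]

theorem hasSquarePrefix_iff {α : Type*} (R : List α) :
    HasSquarePrefix R ↔ ∃ X Y : List α, Y ≠ [] ∧ R = Y ++ Y ++ X := by
  constructor
  · rintro ⟨p, hp, hl, h⟩
    refine ⟨R.drop (2 * p), R.take p, ?_, ?_⟩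
    · rw [← List.length_pos_iff, List.length_take]; omega
    · have key : R.take p = (R.drop p).take p := by
        apply List.ext_getElem?
        intro j
        by_cases hj : j < p
        · simp [hj, h j hj, Nat.add_comm]
        · simp [hj]
      conv_lhs => rw [← List.take_append_drop p R, ← List.take_append_drop p (R.drop p),
        ← key, List.drop_drop, ← two_mul, ← List.append_assoc]
  · rintro ⟨X, Y, hY, rfl⟩
    have := List.length_pos_iff.2 hY
    refine ⟨Y.length, this, by simp; omega, fun j hj => ?_⟩
    rw [List.append_assoc, List.getElem?_append_left hj, List.getElem?_append_right (by omega),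
      Nat.add_sub_cancel, List.getElem?_append_left hj]

theorem CN_eq_one_iff {α : Type*} (S : List α) :
    CN S = 1 ↔ S ≠ [] ∧ ¬ HasSquarePrefix S.reverse := by
  set K : Set ℕ := {k | ∃ X Y : List α, Y ≠ [] ∧ S = X ++ listPow Y k} with hK
  have hbdd : BddAbove K := by
    refine ⟨S.length, ?_⟩
    rintro k ⟨X, Y, hY, rfl⟩
    have := List.length_pos_iff.2 hY
    rw [List.length_append, length_listPow]
    nlinarith
  have hone : S ≠ [] → 1 ∈ K := fun h => ⟨[], S, h, by simp [listPow]⟩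
  have htwo : HasSquarePrefix S.reverse ↔ 2 ∈ K := by
    rw [hasSquarePrefix_iff]
    constructor
    · rintro ⟨X, Y, hY, h⟩
      refine ⟨X.reverse, Y.reverse, by simpa using hY, ?_⟩
      rw [← List.reverse_reverse S, h]
      simp [listPow]
    · rintro ⟨X, Y, hY, h⟩
      exact ⟨X.reverse, Y.reverse, by simpa using hY, by simp [h, listPow]⟩
  have hCN : CN S = sSup K := rfl
  rw [hCN, htwo]
  constructor
  · intro h
    refine ⟨?_, fun h2 => ?_⟩
    · have hne : K.Nonempty := by
        by_contra hK0
        rw [Set.not_nonempty_iff_eq_empty.1 hK0] at h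
        simp at h
      obtain ⟨X, Y, hY, hXY⟩ := Nat.sSup_mem hne hbdd
      rw [h] at hXY
      simp [hXY, listPow, hY]
    · have := le_csSup hbdd h2
      omega
  · rintro ⟨hS, h2⟩
    have hmem := Nat.sSup_mem ⟨1, hone hS⟩ hbdd
    have hge := le_csSup hbdd (hone hS)
    by_contra hne
    obtain ⟨X, Y, hY, h⟩ := hmem
    refine h2 ⟨X ++ listPow Y (sSup K - 2), Y, hY, ?_⟩
    rw [List.append_assoc, ← listPow_add, Nat.sub_add_cancel (by omega)]
    exact h

theorem reverse_suffLen {α : Type*} (S : List α) (i : ℕ) :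
    (suffLen S i).reverse = S.reverse.take i := by
  rw [suffLen, List.take_reverse]

theorem length_suffLen {α : Type*} {S : List α} {i : ℕ} (h : i ≤ S.length) :
    (suffLen S i).length = i := by
  rw [suffLen, List.length_drop]; omega

theorem mem_setA_iff {n i : ℕ} (hn : 0 < n) (S : List Bool) :
    S ∈ setA n i ↔ S.length = n ∧ ¬ HasSquarePrefix (S.reverse ++ S.reverse.take i) := by
  simp only [setA, Set.mem_ofPred_eq, CN_eq_one_iff, List.reverse_append, reverse_suffLen]
  constructor
  · rintro ⟨h, -, -, h'⟩
    exact ⟨h, h'⟩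
  · rintro ⟨h, h'⟩
    have hS : S ≠ [] := List.length_pos_iff.1 (h ▸ hn)
    exact ⟨h, ⟨hS, fun hs => h' (hs.append _)⟩, by simp [hS], h'⟩

theorem mem_setB_iff {n i : ℕ} (hn : 0 < n) (S : List Bool) :
    S ∈ setB n i ↔ S.length = n ∧
      ¬ HasSquarePrefix (S.reverse ++ S.reverse.take i ++ S.reverse) := by
  simp only [setB, Set.mem_ofPred_eq, CN_eq_one_iff, List.reverse_append, reverse_suffLen,
    ← List.append_assoc]
  constructor
  · rintro ⟨h, -, -, h'⟩
    exact ⟨h, h'⟩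
  · rintro ⟨h, h'⟩
    have hS : S ≠ [] := List.length_pos_iff.1 (h ▸ hn)
    refine ⟨h, ⟨hS, fun hs => h' ?_⟩, by simp [hS], h'⟩
    rw [List.append_assoc]
    exact hs.append _

theorem setB_subset_setA {n i : ℕ} (hn : 0 < n) : setB n i ⊆ setA n i := by
  intro S hS
  rw [mem_setB_iff hn] at hS
  rw [mem_setA_iff hn]
  exact ⟨hS.1, fun h => hS.2 (h.append _)⟩

/-- If `R R^{i} R` begins with a square, where `R^{i}` is the prefix of length `i > |R| / 2`, but
`R R^{i}` does not, then `R` has period `i`. -/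
theorem getElem?_eq_of_hasSquarePrefix {α : Type*} {R : List α} {i : ℕ}
    (h1 : R.length < 2 * i) (h2 : i < R.length)
    (hA : ¬ HasSquarePrefix (R ++ R.take i)) (hB : HasSquarePrefix (R ++ R.take i ++ R))
    {j : ℕ} (hj : i ≤ j) (hjn : j < R.length) : R[j]? = R[j - i]? := by
  have hR : ¬ HasSquarePrefix R := fun h => hA (h.append _)
  obtain ⟨p, hp, hl, h⟩ := hB
  have hlen : (R ++ R.take i).length = R.length + i := by simp; omega
  rw [List.length_append, hlen] at hl
  have hfst : ∀ k, k < R.length → (R ++ R.take i ++ R)[k]? = R[k]? := fun k hk => by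
    rw [List.append_assoc, List.getElem?_append_left hk]
  have hsnd : ∀ k, k < i → (R ++ R.take i ++ R)[R.length + k]? = R[k]? := fun k hk => by
    rw [List.getElem?_append_left (by omega), List.getElem?_append_right (by omega)]
    simp [hk]
  have htrd : ∀ k, (R ++ R.take i ++ R)[R.length + i + k]? = R[k]? := fun k => by
    rw [List.getElem?_append_right (by omega), hlen, Nat.add_sub_cancel_left]
  have hlong : R.length + i < 2 * p := by
    by_contra hle
    refine hA ⟨p, hp, by omega, fun k hk => ?_⟩
    have := h k hk
    rwa [List.getElem?_append_left (i := k) (by omega),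
      List.getElem?_append_left (i := k + p) (by omega)] at this
  rcases lt_trichotomy p R.length with hlt | heq | hgt
  · refine absurd ⟨R.length - p, by omega, by omega, fun k hk => ?_⟩ hR
    have := h (k + (R.length - p)) (by omega)
    rw [hfst _ (by omega), show k + (R.length - p) + p = R.length + k by omega,
      hsnd _ (by omega)] at this
    exact this.symm
  · have := h j (by omega)
    rwa [hfst _ hjn, show j + p = R.length + i + (j - i) by omega, htrd] at this
  · refine absurd ⟨p - R.length, by omega, by omega, fun k hk => ?_⟩ hR
    have := h k (by omega)
    rwa [hfst _ (by omega), show k + p = R.length + (k + (p - R.length)) by omega,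
      hsnd _ (by omega)] at this

theorem bijOn_suffLen_append {n i : ℕ} (h1 : n < 2 * i) (h2 : i < n) :
    Set.BijOn (fun T : List Bool => suffLen T (n - i) ++ T) (setB i (n - i))
      (setA n i \ setB n i) := by
  refine ⟨fun T hT => ?_, fun T hT T' hT' h => ?_, fun S hS => ?_⟩
  · rw [mem_setB_iff (by omega)] at hT
    obtain ⟨hl, hT⟩ := hT
    rw [Set.mem_sdiff, mem_setA_iff (by omega), mem_setB_iff (by omega)]
    have hlen : (suffLen T (n - i) ++ T).length = n := by
      rw [List.length_append, length_suffLen (by omega)]; omega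
    have htake : (T.reverse ++ T.reverse.take (n - i)).take i = T.reverse := by
      rw [List.take_append_of_le_length (by simp [hl]), List.take_of_length_le (by simp [hl])]
    simp only [List.reverse_append, reverse_suffLen, htake]
    refine ⟨⟨hlen, hT⟩, fun h => h.2 ?_⟩
    rw [hasSquarePrefix_iff]
    refine ⟨T.reverse.drop (n - i) ++ T.reverse.take (n - i),
      T.reverse ++ T.reverse.take (n - i), ?_, ?_⟩
    · rw [← List.length_pos_iff]; simp; omega
    · conv_lhs => enter [2, 1]; rw [← List.take_append_drop (n - i) T.reverse]
      simp only [List.append_assoc]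
  · exact (List.append_inj' h (hT.1.trans hT'.1.symm)).2
  · rw [Set.mem_sdiff, mem_setA_iff (by omega), mem_setB_iff (by omega)] at hS
    obtain ⟨⟨hl, hA⟩, hB⟩ := hS
    have hB' := by_contra fun hc => hB ⟨hl, hc⟩
    have hrl : S.reverse.length = n := by simp [hl]
    have hper : S.reverse.drop i = (S.reverse.take i).take (n - i) := by
      apply List.ext_getElem?
      intro k
      by_cases hk : k < n - i
      · have := getElem?_eq_of_hasSquarePrefix (by omega) (by omega) hA hB'
          (j := i + k) (by omega) (by omega)
        rw [List.getElem?_drop, this, Nat.add_sub_cancel_left, List.take_take,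
          List.getElem?_take_of_lt (by omega)]
      · rw [List.getElem?_eq_none (by simp; omega), List.getElem?_eq_none (by simp; omega)]
    have hrev : S.reverse = S.reverse.take i ++ (S.reverse.take i).take (n - i) := by
      rw [← hper, List.take_append_drop]
    refine ⟨suffLen S i, ?_, ?_⟩
    · rw [mem_setB_iff (by omega), reverse_suffLen, ← hrev]
      exact ⟨length_suffLen (by omega), hA⟩
    · apply List.reverse_injective
      simp only [List.reverse_append, reverse_suffLen]
      exact hrev.symm

theorem finite_setA (n i : ℕ) : (setA n i).Finite :=
  (List.finite_length_eq Bool n).subset fun _ h => h.1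

/-- For `n/2 < i < n`, the sets `A(n,i) \ B(n,i)` and `B(i, n-i)` are in bijection;
in particular `a(n,i) - b(n,i) = b(i, n-i)`. -/
theorem thA6 (n i : ℕ) (h1 : n < 2 * i) (h2 : i < n) :
    Nonempty ((setA n i \ setB n i : Set (List Bool)) ≃ (setB i (n - i) : Set (List Bool))) ∧
    (aCount n i : ℤ) - (bCount n i : ℤ) = (bCount i (n - i) : ℤ) := by
  have e := (bijOn_suffLen_append h1 h2).equiv
  refine ⟨⟨e.symm⟩, ?_⟩
  have hcard : bCount i (n - i) = (setA n i \ setB n i).ncard := Nat.card_congr e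
  have hsub : setB n i ⊆ setA n i := setB_subset_setA (by omega)
  have hdiff := Set.ncard_sdiff_add_ncard_of_subset hsub (finite_setA n i)
  rw [hcard, aCount, bCount, ← hdiff]
  push_cast
  ring
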